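/- Let R be a commutative noetherian local ring with maximal ideal m and let L be a free R-module. Then the inclusion L → L̂ into the m-adic completion is a pure monomorphism of R-modules; consequently the quotient L' = L̂/L is a flat R-module. -/

import Mathlib

section FreeModuleRelations

variable {R L β ι κ : Type*} [CommRing R] [AddCommGroup L] [Module R L]

/-- A vector lies in `J • ⊤` iff all its coordinates lie in `J`. -/
theorem Module.Basis.mem_ideal_smul_top_iff (b : Module.Basis β R L) (J : Ideal R) (x : L) :
    x ∈ (J • ⊤ : Submodule R L) ↔ ∀ i, b.repr x i ∈ J := by
  refine ⟨fun hx i => ?_, fun h => ?_⟩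
  · have := Submodule.mem_map_of_mem (f := b.coord i) hx
    rw [Submodule.map_smul''] at this
    have h := smul_mono_right J (le_top : Submodule.map (b.coord i) ⊤ ≤ ⊤) this
    simpa using h
  · rw [← b.linearCombination_repr x, Finsupp.linearCombination_apply]
    exact Submodule.sum_mem _ fun i _ => Submodule.smul_mem_smul (h i) trivial

/-- Coordinatewise choice of finitely many vectors: outside of a finite set of coordinates, the
condition should be satisfied by zero. -/
theorem Module.Basis.exists_forall_repr (b : Module.Basis β R L) (S : Finset β)
    (P : β → (κ → R) → Prop) (hP : ∀ i, ∃ g, P i g) (h0 : ∀ i ∉ S, P i 0) :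
    ∃ w : κ → L, ∀ i, P i fun j => b.repr (w j) i := by
  classical
  choose g hg using hP
  refine ⟨fun j => b.repr.symm (Finsupp.onFinset S (fun i => if i ∈ S then g i j else 0)
    (by aesop)), fun i => ?_⟩
  by_cases hi : i ∈ S
  · simpa [hi] using hg i
  · simpa [hi] using! h0 i hi

variable [Fintype κ]

/-- A uniform Artin-Rees lemma for a matrix acting on vectors in a free module. -/
theorem exists_artinRees_of_matrix [IsNoetherianRing R] [Module.Free R L] [Finite ι] (I : Ideal R)
    (A : ι → κ → R) :
    ∃ k : ℕ, ∀ (n : ℕ) (v : κ → L),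
      (∀ i, ∑ j, A i j • v j ∈ (I ^ (n + k) • ⊤ : Submodule R L)) →
      ∃ w : κ → L, (∀ j, w j ∈ (I ^ n • ⊤ : Submodule R L)) ∧
        ∀ i, ∑ j, A i j • w j = ∑ j, A i j • v j := by
  classical
  have := Fintype.ofFinite ι
  let φ : (κ → R) →ₗ[R] (ι → R) := Matrix.mulVecLin A
  have hφ (g : κ → R) (i : ι) : φ g i = ∑ j, A i j * g j := rfl
  obtain ⟨k, hk⟩ := Ideal.exists_pow_inf_eq_pow_smul I (LinearMap.range φ)
  refine ⟨k, fun n v hv => ?_⟩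
  let b := Module.Free.chooseBasis R L
  have key (g : κ → R) (hg : ∀ i, φ g i ∈ I ^ (n + k)) :
      ∃ h : κ → R, (∀ j, h j ∈ I ^ n) ∧ φ h = φ g := by
    have h1 : φ g ∈ (I ^ (n + k) • ⊤ ⊓ LinearMap.range φ : Submodule R (ι → R)) :=
      ⟨((Pi.basisFun R ι).mem_ideal_smul_top_iff _ _).2 (by simpa using hg), ⟨g, rfl⟩⟩
    rw [hk _ (by lia), Nat.add_sub_cancel] at h1
    have h2 := (smul_mono_right (I ^ n) inf_le_right :
      _ ≤ I ^ n • LinearMap.range φ) h1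
    rw [← Submodule.map_top, ← Submodule.map_smul''] at h2
    obtain ⟨h, hh, e⟩ := h2
    exact ⟨h, by simpa using ((Pi.basisFun R κ).mem_ideal_smul_top_iff _ _).1 hh, e⟩
  obtain ⟨w, hw⟩ := b.exists_forall_repr (Finset.univ.biUnion fun j => (b.repr (v j)).support)
    (fun i h => (∀ j, h j ∈ I ^ n) ∧ φ h = φ fun j => b.repr (v j) i)
    (fun i => key _ fun r => by
      simpa [hφ] using (b.mem_ideal_smul_top_iff _ _).1 (hv r) i)
    (fun i hi => by
      have : (fun j => b.repr (v j) i) = 0 := by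
        ext j; exact by_contra fun h => hi (by simpa using ⟨j, h⟩)
      simp [this])
  refine ⟨w, fun j => (b.mem_ideal_smul_top_iff _ _).2 fun i => (hw i).1 j, fun r => ?_⟩
  refine b.repr.injective (Finsupp.ext fun i => ?_)
  simpa [hφ] using congrFun (hw i).2 r

/-- Generators of the relations between ring elements `f i` also generate the relations with
coefficients in a free module. -/
theorem exists_eq_sum_smul_of_free [Module.Free R L] [Fintype ι] {f : ι → R} {A : ι → κ → R}
    (hA : ∀ g : ι → R, ∑ i, f i * g i = 0 → ∃ h : κ → R, ∀ i, g i = ∑ j, A i j * h j)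
    {v : ι → L} (hv : ∑ i, f i • v i = 0) :
    ∃ y : κ → L, ∀ i, v i = ∑ j, A i j • y j := by
  classical
  let b := Module.Free.chooseBasis R L
  obtain ⟨y, hy⟩ := b.exists_forall_repr (Finset.univ.biUnion fun j => (b.repr (v j)).support)
    (fun i (h : κ → R) => ∀ r, b.repr (v r) i = ∑ j, A r j * h j)
    (fun i => hA _ (by simpa using congrArg (fun x => b.repr x i) hv))
    (fun i hi r => by
      have : b.repr (v r) i = 0 := by_contra fun h => hi (by simpa using ⟨r, h⟩)
      simp [this])
  refine ⟨y, fun r => b.repr.injective (Finsupp.ext fun i => ?_)⟩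
  simpa using hy i r

/-- Krull's intersection theorem for the submodule `J L` of a free module `L` over a noetherian
local ring, where `J` is the ideal generated by the `f j`. -/
theorem exists_eq_sum_smul_of_forall_sub_mem [IsNoetherianRing R] [IsLocalRing R]
    [Module.Free R L] {f : κ → R} {x : L}
    (hx : ∀ n : ℕ, ∃ v : κ → L,
      x - ∑ j, f j • v j ∈ (IsLocalRing.maximalIdeal R ^ n • ⊤ : Submodule R L)) :
    ∃ v : κ → L, x = ∑ j, f j • v j := by
  let b := Module.Free.chooseBasis R L
  have key (r : R) (hr : ∀ n : ℕ, ∃ g : κ → R,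
      r - ∑ j, f j * g j ∈ IsLocalRing.maximalIdeal R ^ n) : ∃ g : κ → R, r = ∑ j, f j * g j := by
    let J := Ideal.span (Set.range f)
    have hf (g : κ → R) : ∑ j, f j * g j ∈ J := Ideal.sum_mem _ fun j _ =>
      J.mul_mem_right _ (Ideal.subset_span ⟨j, rfl⟩)
    have hJ : r ∈ J := by
      rw [← Ideal.Quotient.eq_zero_iff_mem]
      refine (inferInstance : IsHausdorff (IsLocalRing.maximalIdeal R) (R ⧸ J)).haus' _ fun n => ?_
      obtain ⟨g, hg⟩ := hr n
      rw [SModEq.zero]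
      have e : (Ideal.Quotient.mk J r) = (r - ∑ j, f j * g j) • (1 : R ⧸ J) := by
        rw [Algebra.smul_def, mul_one, Ideal.Quotient.algebraMap_eq, map_sub,
          Ideal.Quotient.eq_zero_iff_mem.2 (hf g), sub_zero]
      rw [e]
      exact Submodule.smul_mem_smul hg trivial
    obtain ⟨g, hg⟩ := (Ideal.mem_span_range_iff_exists_fun).1 hJ
    exact ⟨g, by simp [← hg, mul_comm]⟩
  obtain ⟨v, hv⟩ := b.exists_forall_repr (b.repr x).support
    (fun i (g : κ → R) => b.repr x i = ∑ j, f j * g j)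
    (fun i => key _ fun n => by
      obtain ⟨v, hv⟩ := hx n
      exact ⟨fun j => b.repr (v j) i, by simpa using (b.mem_ideal_smul_top_iff _ _).1 hv i⟩)
    (fun i hi => by simpa using hi)
  exact ⟨v, b.repr.injective (Finsupp.ext fun i => by simpa using hv i)⟩

end FreeModuleRelations

namespace AdicCompletion

theorem val_sum_smul_mk {R L : Type*} [CommRing R] [AddCommGroup L] [Module R L]
    {I : Ideal R} {κ : Type*} [Fintype κ] (f : κ → R)
    (s : κ → AdicCauchySequence I L) (n : ℕ) :
    (∑ j, f j • mk I L (s j)).val n = Submodule.Quotient.mk (∑ j, f j • s j n) := by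
  rw [val_sum_apply, ← Submodule.mkQ_apply, map_sum]
  rfl

variable {R L : Type*} [CommRing R] [IsNoetherianRing R] [AddCommGroup L] [Module R L]
  [Module.Free R L]

/-- The adic completion of a free module over a noetherian ring is flat. -/
theorem flat_of_free (I : Ideal R) : Module.Flat R (AdicCompletion I L) := by
  refine Module.Flat.of_forall_isTrivialRelation fun {l f x} hx => ?_
  choose s hs using fun i => mk_surjective I L (x i)
  have hfs (n : ℕ) : ∑ i, f i • s i n ∈ (I ^ n • ⊤ : Submodule R L) := by
    rw [← Submodule.Quotient.mk_eq_zero]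
    simpa only [← hs, val_sum_smul_mk, val_zero_apply] using congrArg (fun z => z.val n) hx
  obtain ⟨p, A, hfA, hA⟩ : ∃ (p : ℕ) (A : Fin l → Fin p → R), (∀ j, ∑ i, f i * A i j = 0) ∧
      ∀ g : Fin l → R, ∑ i, f i * g i = 0 → ∃ h : Fin p → R, ∀ i, g i = ∑ j, A i j * h j := by
    let φ : (Fin l → R) →ₗ[R] R := ∑ i, f i • LinearMap.proj i
    have hφ (g : Fin l → R) : φ g = ∑ i, f i * g i := by simp [φ]
    obtain ⟨p, a, ha⟩ := Submodule.fg_iff_exists_fin_generating_family.1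
      (IsNoetherian.noetherian (LinearMap.ker φ))
    refine ⟨p, fun i j => a j i, fun j => ?_, fun g hg => ?_⟩
    · rw [← hφ, ← LinearMap.mem_ker, ← ha]
      exact Submodule.subset_span ⟨j, rfl⟩
    · rw [← hφ, ← LinearMap.mem_ker, ← ha, Submodule.mem_span_range_iff_exists_fun] at hg
      obtain ⟨h, rfl⟩ := hg
      exact ⟨h, fun i => by simp [mul_comm]⟩
  obtain ⟨k, hk⟩ := exists_artinRees_of_matrix (L := L) I (fun _ : Unit => f)
  obtain ⟨k', hk'⟩ := exists_artinRees_of_matrix (L := L) I A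
  choose w hw hfw using fun n => hk n (fun i => s i (n + k)) fun _ => hfs (n + k)
  choose y hy using fun n => exists_eq_sum_smul_of_free hA
    (v := fun i => s i (n + k) - w n i) (by simp [smul_sub, hfw n ()])
  have mono {m n : ℕ} (h : m ≤ n) : (I ^ n • ⊤ : Submodule R L) ≤ I ^ m • ⊤ :=
    Submodule.smul_mono_left (Ideal.pow_le_pow_right h)
  have hs' {m n : ℕ} (h : m ≤ n) (i : Fin l) : s i n - s i m ∈ (I ^ m • ⊤ : Submodule R L) :=
    (Submodule.Quotient.eq _).1 (AdicCauchySequence.mk_eq_mk h (s i))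
  choose z hz hAz using fun n => hk' n (fun j => y (n + k' + 1) j - y (n + k') j) fun i => by
    simp only [smul_sub, Finset.sum_sub_distrib, ← hy]
    have h1 := mono (by lia) (hs' (show n + k' + k ≤ n + k' + 1 + k by lia) i) (m := n + k')
    have h2 := mono (by lia) (hw (n + k' + 1) i) (m := n + k')
    convert Submodule.add_mem _ (Submodule.sub_mem _ h1 h2) (hw (n + k') i) using 1
    abel
  let Z (j : Fin p) : AdicCauchySequence I L := .mk I L
    (fun n => y k' j + ∑ m ∈ Finset.range n, z m j) fun n => by
      rw [SModEq.comm, SModEq.sub_mem]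
      simpa [Finset.sum_range_succ] using hz n j
  have hZ (n : ℕ) (i : Fin l) : ∑ j, A i j • Z j n = s i (n + k' + k) - w (n + k') i := by
    rw [hy]
    induction n with
    | zero => simp [Z]
    | succ n ih =>
      have e (j : Fin p) : Z j (n + 1) = Z j n + z n j := by
        simp [Z, Finset.sum_range_succ, add_assoc]
      simp only [e, smul_add, Finset.sum_add_distrib, ih, hAz, smul_sub, Finset.sum_sub_distrib]
      rw [show n + 1 + k' = n + k' + 1 by lia]
      abel
  refine ⟨p, A, fun j => mk I L (Z j), fun i => ?_, hfA⟩
  rw [← hs]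
  ext n
  rw [val_sum_smul_mk, hZ, mk_apply_coe, Submodule.mkQ_apply, eq_comm, Submodule.Quotient.eq]
  have h1 := hs' (show n ≤ n + k' + k by lia) i
  convert Submodule.sub_mem _ h1 (mono (by lia) (hw (n + k') i)) using 1
  abel

variable [IsLocalRing R]

open IsLocalRing (maximalIdeal)

/-- If `x ∈ L` is a combination of the `f j` in the completion of `L`, then it is one in `L`. -/
theorem exists_eq_sum_smul_of_of_eq_sum_smul {κ : Type*} [Fintype κ] {f : κ → R} {x : L}
    {v : κ → AdicCompletion (maximalIdeal R) L}
    (h : of (maximalIdeal R) L x = ∑ j, f j • v j) :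
    ∃ v : κ → L, x = ∑ j, f j • v j := by
  refine exists_eq_sum_smul_of_forall_sub_mem fun n => ?_
  choose s hs using fun j => mk_surjective (maximalIdeal R) L (v j)
  refine ⟨fun j => s j n, ?_⟩
  rw [← Submodule.Quotient.eq]
  simpa only [← hs, val_sum_smul_mk, of_apply, Submodule.mkQ_apply] using
    congrArg (fun z => z.val n) h

/-- A free module over a noetherian local ring embeds into its completion. -/
theorem of_injective_of_free : Function.Injective (of (maximalIdeal R) L) := by
  rw [injective_iff_map_eq_zero]
  intro x hx
  obtain ⟨v, hv⟩ := exists_eq_sum_smul_of_of_eq_sum_smul (κ := Empty) (f := Empty.elim)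
    (v := Empty.elim) (by simpa using hx)
  simpa using hv

/-- The cokernel of the completion map of a free module is flat. -/
theorem quotient_range_of_flat :
    Module.Flat R (AdicCompletion (maximalIdeal R) L ⧸ (of (maximalIdeal R) L).range) := by
  have := flat_of_free (L := L) (maximalIdeal R)
  refine Module.Flat.of_forall_isTrivialRelation fun {l f x} hx => ?_
  choose u hu using fun i => Submodule.mkQ_surjective (of (maximalIdeal R) L).range (x i)
  obtain ⟨a, ha⟩ : ∑ i, f i • u i ∈ (of (maximalIdeal R) L).range := by
    rw [← Submodule.ker_mkQ (of (maximalIdeal R) L).range, LinearMap.mem_ker]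
    simpa [hu] using hx
  obtain ⟨v, rfl⟩ := exists_eq_sum_smul_of_of_eq_sum_smul ha
  obtain ⟨p, A, y, hy, hA⟩ := Module.Flat.isTrivialRelation_of_sum_smul_eq_zero
    (f := f) (x := fun i => u i - of (maximalIdeal R) L (v i)) (by simp [smul_sub, ← ha])
  refine ⟨p, A, fun j => Submodule.mkQ _ (y j), fun i => ?_, hA⟩
  have hv : Submodule.mkQ (of (maximalIdeal R) L).range (of (maximalIdeal R) L (v i)) = 0 := by
    simp
  rw [← hu, ← sub_zero (Submodule.mkQ _ (u i)), ← hv, ← map_sub]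
  refine (congrArg _ (hy i)).trans ?_
  simp only [map_sum, map_smul]

end AdicCompletion

/-- Over a commutative noetherian local ring `(R, 𝔪)`, for a free
`R`-module `L` the inclusion `L → L̂` into the `𝔪`-adic completion is a pure monomorphism
(it stays injective after tensoring with every `R`-module), and consequently the quotient
`L' = L̂ / L` is a flat `R`-module. -/
theorem of_adicCompletion_pure_and_quotient_flat
    {R : Type u} [CommRing R] [IsNoetherianRing R] [IsLocalRing R]
    (L : Type u) [AddCommGroup L] [Module R L] [Module.Free R L] :
    (∀ (N : Type u) [AddCommGroup N] [Module R N],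
        Function.Injective
          (LinearMap.rTensor N (AdicCompletion.of (IsLocalRing.maximalIdeal R) L))) ∧
    Module.Flat R
      (AdicCompletion (IsLocalRing.maximalIdeal R) L ⧸
        LinearMap.range (AdicCompletion.of (IsLocalRing.maximalIdeal R) L)) := by
  have hflat := AdicCompletion.quotient_range_of_flat (R := R) (L := L)
  refine ⟨fun N _ _ => ?_, hflat⟩
  rw [← LinearMap.lTensor_inj_iff_rTensor_inj]
  exact LinearMap.lTensor_injective_of_exact_of_flat (Submodule.mkQ _)
    (Submodule.mkQ_surjective _) _ AdicCompletion.of_injective_of_free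
    (LinearMap.exact_map_mkQ_range _) N
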